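/- arXiv:2303.02664 — 7 statements merged into one kernel-verified Lean document; each statement's English description precedes it below -/
import Mathlib

section
/- For every known-deadline instance and every linear contiguous schedule (b, t), there exists a linear contiguous schedule (b', t') that is back-to-back and non-tardy and whose overall success probability is at least that of (b, t). That is, computation allocated to a process after its deadline, and idle gaps between blocks, can always be removed without decreasing the overall success probability. -/
/-- Success probability of a process with known deadline `d`, performance profile `M`,
when allocated `t` consecutive time units beginning at time `b`. -/
noncomputable def procSuccess (d : ℕ) (M : ℕ → ℝ) (b t : ℕ) : ℝ :=
  if b ≤ d then M (min t (d - b)) else 0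

/-- Overall success probability of a linear contiguous schedule `(b, t)`. -/
noncomputable def overallSuccess (n : ℕ) (d : Fin n → ℕ) (M : Fin n → ℕ → ℝ)
    (b t : Fin n → ℕ) : ℝ :=
  1 - ∏ i, (1 - procSuccess (d i) (M i) (b i) (t i))

/-- The blocks `[bᵢ, bᵢ + tᵢ)` are pairwise disjoint. -/
def DisjointSched (n : ℕ) (b t : Fin n → ℕ) : Prop :=
  ∀ i j, i ≠ j → Disjoint (Set.Ico (b i) (b i + t i)) (Set.Ico (b j) (b j + t j))

/-- Every block of positive duration finishes by its process's deadline. -/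
def NonTardy (n : ℕ) (d : Fin n → ℕ) (b t : Fin n → ℕ) : Prop :=
  ∀ i, 0 < t i → b i + t i ≤ d i

/-- The union of the blocks is the interval `[0, ∑ᵢ tᵢ)`. -/
def BackToBack (n : ℕ) (b t : Fin n → ℕ) : Prop :=
  (⋃ i, Set.Ico (b i) (b i + t i)) = Set.Ico 0 (∑ i, t i)

/-- The start times obtained by left-shifting the blocks of positive duration of `(b, t)` so that no
gap remains; blocks of duration zero start at zero. -/
def compactStart {n : ℕ} (b t : Fin n → ℕ) (i : Fin n) : ℕ :=
  if t i = 0 then 0 else ∑ j with b j < b i, t j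

theorem DisjointSched.le_or_le {n : ℕ} {b t : Fin n → ℕ} (h : DisjointSched n b t) {i j : Fin n}
    (hij : i ≠ j) (hi : 0 < t i) (hj : 0 < t j) : b i + t i ≤ b j ∨ b j + t j ≤ b i := by
  have := h i j hij
  rw [Set.Ico_disjoint_Ico] at this
  omega

theorem disjointSched_of_le_or_le {n : ℕ} {b t : Fin n → ℕ}
    (h : ∀ i j, i ≠ j → 0 < t i → 0 < t j → b i + t i ≤ b j ∨ b j + t j ≤ b i) :
    DisjointSched n b t := by
  intro i j hij
  rw [Set.Ico_disjoint_Ico]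
  have := h i j hij
  omega

theorem DisjointSched.mono {n : ℕ} {b t t' : Fin n → ℕ} (h : DisjointSched n b t)
    (ht : ∀ i, t' i ≤ t i) : DisjointSched n b t' := fun i j hij =>
  (h i j hij).mono (Set.Ico_subset_Ico_right (by have := ht i; omega))
    (Set.Ico_subset_Ico_right (by have := ht j; omega))

theorem DisjointSched.card_biUnion {n : ℕ} {b t : Fin n → ℕ} (h : DisjointSched n b t)
    (s : Finset (Fin n)) : (s.biUnion fun i => Finset.Ico (b i) (b i + t i)).card = ∑ i ∈ s, t i := by
  rw [Finset.card_biUnion]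
  · simp
  · intro i _ j _ hij
    rw [Function.onFun, ← Finset.disjoint_coe]
    simpa using h i j hij

theorem DisjointSched.compactStart_le {n : ℕ} {b t : Fin n → ℕ} (h : DisjointSched n b t)
    (i : Fin n) : compactStart b t i ≤ b i := by
  unfold compactStart
  split_ifs with hi
  · exact Nat.zero_le _
  · rw [← h.card_biUnion, ← Finset.card_range (b i)]
    refine Finset.card_le_card fun x hx => ?_
    simp only [Finset.mem_biUnion, Finset.mem_filter, Finset.mem_univ, true_and, Finset.mem_Ico,
      Finset.card_range, Finset.mem_range] at hx ⊢
    obtain ⟨j, hj, hx⟩ := hx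
    have := h.le_or_le (i := i) (j := j) (by rintro rfl; omega) (by omega) (by omega)
    omega

theorem compactStart_add_le_sum {n : ℕ} {b t : Fin n → ℕ} {i : Fin n} (hi : 0 < t i)
    {s : Finset (Fin n)} (his : i ∈ s) (hs : ∀ j, b j < b i → j ∈ s) :
    compactStart b t i + t i ≤ ∑ j ∈ s, t j := by
  rw [compactStart, if_neg hi.ne', add_comm, ← Finset.sum_insert (by simp)]
  refine Finset.sum_le_sum_of_subset fun j hj => ?_
  simp only [Finset.mem_insert, Finset.mem_filter, Finset.mem_univ, true_and] at hj
  rcases hj with rfl | hj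
  · exact his
  · exact hs j hj

theorem DisjointSched.compact {n : ℕ} {b t : Fin n → ℕ} (h : DisjointSched n b t) :
    DisjointSched n (compactStart b t) t := by
  have key : ∀ i j, b i < b j → 0 < t i → 0 < t j →
      compactStart b t i + t i ≤ compactStart b t j := by
    intro i j hij hi hj
    rw [compactStart.eq_def b t j, if_neg hj.ne']
    exact compactStart_add_le_sum hi (by simpa using hij)
      fun k hk => by simpa using hk.trans hij
  refine disjointSched_of_le_or_le fun i j hij hi hj => ?_
  rcases h.le_or_le hij hi hj with hb | hb
  · exact Or.inl (key i j (by omega) hi hj)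
  · exact Or.inr (key j i (by omega) hj hi)

theorem DisjointSched.backToBack_compact {n : ℕ} {b t : Fin n → ℕ} (h : DisjointSched n b t) :
    BackToBack n (compactStart b t) t := by
  have heq : (Finset.univ.biUnion fun i =>
      Finset.Ico (compactStart b t i) (compactStart b t i + t i)) = Finset.Ico 0 (∑ i, t i) := by
    refine Finset.eq_of_subset_of_card_le (fun x hx => ?_) (by simp [h.compact.card_biUnion])
    simp only [Finset.mem_biUnion, Finset.mem_univ, true_and, Finset.mem_Ico] at hx ⊢
    obtain ⟨i, hx⟩ := hx
    have := compactStart_add_le_sum (b := b) (t := t) (i := i) (s := Finset.univ) (by omega)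
      (by simp) (by simp)
    omega
  have := congrArg (fun s : Finset ℕ => (s : Set ℕ)) heq
  simpa only [BackToBack, Finset.coe_biUnion, Finset.coe_univ, Set.mem_univ, Set.iUnion_true,
    Finset.coe_Ico] using this

theorem procSuccess_mem_Icc {d : ℕ} {M : ℕ → ℝ} (hM : ∀ t, 0 ≤ M t ∧ M t ≤ 1) (b t : ℕ) :
    procSuccess d M b t ∈ Set.Icc 0 1 := by
  unfold procSuccess
  split_ifs
  · exact hM _
  · simp

theorem overallSuccess_mono {n : ℕ} {d : Fin n → ℕ} {M : Fin n → ℕ → ℝ}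
    (hM : ∀ i t, 0 ≤ M i t ∧ M i t ≤ 1) {b t b' t' : Fin n → ℕ}
    (h : ∀ i, procSuccess (d i) (M i) (b i) (t i) ≤ procSuccess (d i) (M i) (b' i) (t' i)) :
    overallSuccess n d M b t ≤ overallSuccess n d M b' t' :=
  sub_le_sub_left (Finset.prod_le_prod
    (fun i _ => sub_nonneg.2 (procSuccess_mem_Icc (hM i) _ _).2)
    fun i _ => sub_le_sub_left (h i) 1) 1

/-- Starting earlier with the tardy part cut off does not decrease the success probability. -/
theorem procSuccess_le_truncate {d : ℕ} {M : ℕ → ℝ} (hmono : Monotone M)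
    (hM : ∀ t, 0 ≤ M t ∧ M t ≤ 1) {b b' : ℕ} (hb : b' ≤ b) (t : ℕ) :
    procSuccess d M b t ≤ procSuccess d M b' (min t (d - b)) := by
  by_cases hd : b ≤ d
  · rw [procSuccess, procSuccess, if_pos hd, if_pos (hb.trans hd)]
    exact hmono (by omega)
  · rw [procSuccess, if_neg hd]
    exact (procSuccess_mem_Icc hM _ _).1

/-- Tardy computation and idle gaps can always be removed without decreasing the
overall success probability. -/
theorem stmt3 (n : ℕ) (d : Fin n → ℕ) (M : Fin n → ℕ → ℝ)
    (hMmono : ∀ i, Monotone (M i)) (hM0 : ∀ i, M i 0 = 0)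
    (hM01 : ∀ i t, 0 ≤ M i t ∧ M i t ≤ 1)
    (b t : Fin n → ℕ) (hdisj : DisjointSched n b t) :
    ∃ b' t' : Fin n → ℕ, DisjointSched n b' t' ∧ BackToBack n b' t' ∧
      NonTardy n d b' t' ∧
      overallSuccess n d M b t ≤ overallSuccess n d M b' t' := by
  have h : DisjointSched n b fun i => min (t i) (d i - b i) := hdisj.mono fun i => min_le_left _ _
  refine ⟨_, _, h.compact, h.backToBack_compact, fun i hi => ?_, overallSuccess_mono hM01 fun i =>
    procSuccess_le_truncate (hMmono i) (hM01 i) (h.compactStart_le i) (t i)⟩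
  have := h.compactStart_le i
  dsimp only at hi ⊢
  omega
end

section
/- Let (b, t) be a non-tardy back-to-back linear contiguous schedule of a known-deadline instance in which the block of process i immediately precedes the block of process j (i.e., b_j = b_i + t_i), with t_i, t_j > 0 and d_j ≤ d_i. Then the schedule obtained by exchanging the two blocks — process j starting at b_i with duration t_j, process i starting at b_i + t_j with duration t_i, all other blocks unchanged — is again a non-tardy back-to-back linear contiguous schedule, and it has the same overall success probability as (b, t). -/
/-- A process that finishes by its deadline succeeds with
the probability given by its full allocation. -/
theorem procSuccess_of_add_le {d b t : ℕ} (M : ℕ → ℝ) (h : b + t ≤ d) :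
    procSuccess d M b t = M t := by
  rw [procSuccess, if_pos (by omega), min_eq_left (by omega)]

theorem disjoint_Ico_nat_iff {a b c e : ℕ} :
    Disjoint (Set.Ico a b) (Set.Ico c e) ↔ ∀ x, a ≤ x → x < b → c ≤ x → x < e → False := by
  simp only [Set.disjoint_left, Set.mem_Ico, not_and, not_lt, and_imp]
  exact forall_congr' fun x => by grind

/-- Exchanging two adjacent blocks, the later of which has the earlier (or equal)
deadline, preserves disjointness, back-to-backness, non-tardiness, and the overall
success probability. -/
theorem stmt4 (n : ℕ) (d : Fin n → ℕ) (M : Fin n → ℕ → ℝ)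
    (hMmono : ∀ i, Monotone (M i)) (hM0 : ∀ i, M i 0 = 0)
    (hM01 : ∀ i t, 0 ≤ M i t ∧ M i t ≤ 1)
    (b t : Fin n → ℕ)
    (hdisj : DisjointSched n b t) (hbtb : BackToBack n b t)
    (hnt : NonTardy n d b t)
    (i j : Fin n) (hij : i ≠ j) (hadj : b j = b i + t i)
    (hti : 0 < t i) (htj : 0 < t j) (hd : d j ≤ d i)
    (b' : Fin n → ℕ)
    (hb' : b' = Function.update (Function.update b j (b i)) i (b i + t j)) :
    DisjointSched n b' t ∧ BackToBack n b' t ∧ NonTardy n d b' t ∧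
      overallSuccess n d M b' t = overallSuccess n d M b t := by
  have hbi : b' i = b i + t j := by simp [hb']
  have hbj : b' j = b i := by simp [hb', hij.symm]
  have hbk : ∀ k, k ≠ i → k ≠ j → b' k = b k := fun k hki hkj => by simp [hb', hki, hkj]
  clear hb'
  have hi := hnt i hti
  have hj := hnt j htj
  refine ⟨?_, ?_, ?_, ?_⟩
  · have hthird : ∀ k, k ≠ i → k ≠ j → ∀ x, b i ≤ x → x < b i + t i + t j →
        b k ≤ x → x < b k + t k → False := by
      intro k hki hkj x h1 h2 h3 h4
      have hik := disjoint_Ico_nat_iff.1 (hdisj k i hki) x h3 h4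
      have hjk := disjoint_Ico_nat_iff.1 (hdisj k j hkj) x h3 h4
      by_cases hx : x < b i + t i
      · exact hik h1 hx
      · exact hjk (by omega) (by omega)
    intro k l hkl
    rw [disjoint_Ico_nat_iff]
    intro x h1 h2 h3 h4
    by_cases hki : k = i <;> by_cases hkj : k = j <;> by_cases hli : l = i <;>
      by_cases hlj : l = j
    all_goals first
      | (subst_vars; first | contradiction | omega)
      | skip
    all_goals try rw [hbk k hki hkj] at h1 h2
    all_goals try rw [hbk l hli hlj] at h3 h4
    · subst hki; exact hthird l hli hlj x (by omega) (by omega) h3 h4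
    · subst hkj; exact hthird l hli hlj x (by omega) (by omega) h3 h4
    · subst hli; exact hthird k hki hkj x (by omega) (by omega) h1 h2
    · subst hlj; exact hthird k hki hkj x (by omega) (by omega) h1 h2
    · exact disjoint_Ico_nat_iff.1 (hdisj k l hkl) x h1 h2 h3 h4
  · rw [BackToBack, ← hbtb]
    ext x
    simp only [Set.mem_iUnion, Set.mem_Ico]
    constructor
    · rintro ⟨k, h1, h2⟩
      by_cases hk : k = i ∨ k = j
      · have hx : b i ≤ x ∧ x < b i + t i + t j := by
          rcases hk with rfl | rfl <;> omega
        by_cases hxi : x < b i + t i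
        · exact ⟨i, by omega, hxi⟩
        · exact ⟨j, by omega, by omega⟩
      · rw [not_or] at hk
        rw [hbk k hk.1 hk.2] at h1 h2
        exact ⟨k, h1, h2⟩
    · rintro ⟨k, h1, h2⟩
      by_cases hk : k = i ∨ k = j
      · have hx : b i ≤ x ∧ x < b i + t i + t j := by
          rcases hk with rfl | rfl <;> omega
        by_cases hxj : x < b i + t j
        · exact ⟨j, by omega, by omega⟩
        · exact ⟨i, by omega, by omega⟩
      · rw [not_or] at hk
        rw [← hbk k hk.1 hk.2] at h1 h2
        exact ⟨k, h1, h2⟩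
  · intro k hk
    by_cases hki : k = i
    · subst hki; omega
    by_cases hkj : k = j
    · subst hkj; omega
    rw [hbk k hki hkj]
    exact hnt k hk
  · unfold overallSuccess
    congr 1
    refine Finset.prod_congr rfl fun k _ => ?_
    by_cases hki : k = i
    · subst hki
      rw [procSuccess_of_add_le _ hi, procSuccess_of_add_le _ (by omega)]
    by_cases hkj : k = j
    · subst hkj
      rw [procSuccess_of_add_le _ hj, procSuccess_of_add_le _ (by omega)]
    rw [hbk k hki hkj]
end

section
/- (Theorem 1, restricted to linear contiguous schedules.) For every known-deadline instance and every linear contiguous schedule (b, t), there exists a linear contiguous schedule (b', t') that is back-to-back and non-tardy, in which the blocks of positive duration occur in nondecreasing order of deadlines (i.e., whenever t'_i > 0, t'_j > 0 and b'_i < b'_j, one has d_i ≤ d_j), and whose overall success probability is at least that of (b, t). -/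
/-- The total duration of the processes whose key is smaller than that of `i`: the start time of
`i` when processes run back to back in increasing order of the key `k`. -/
def startBefore {ι α : Type*} [Fintype ι] [LinearOrder α] (k : ι → α) (t : ι → ℕ) (i : ι) : ℕ :=
  ∑ j with k j < k i, t j

section startBefore

variable {ι α : Type*} [Fintype ι] [LinearOrder α] {k : ι → α}

theorem startBefore_add (hk : Function.Injective k) (t : ι → ℕ) (i : ι) :
    startBefore k t i + t i = ∑ j with k j ≤ k i, t j := by
  classical
  have h : (Finset.univ.filter fun j => k j ≤ k i) =
      insert i (Finset.univ.filter fun j => k j < k i) := by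
    ext j
    simp [le_iff_eq_or_lt, hk.eq_iff]
  rw [h, Finset.sum_insert (by simp), add_comm, startBefore]

theorem startBefore_add_le (hk : Function.Injective k) (t : ι → ℕ) {i j : ι} (h : k i < k j) :
    startBefore k t i + t i ≤ startBefore k t j := by
  rw [startBefore_add hk]
  refine Finset.sum_le_sum_of_subset fun l hl => ?_
  simp only [Finset.mem_filter, Finset.mem_univ, true_and] at hl ⊢
  exact hl.trans_lt h

end startBefore

theorem disjointSched_startBefore {n : ℕ} {α : Type*} [LinearOrder α] {k : Fin n → α}
    (hk : Function.Injective k) (t : Fin n → ℕ) : DisjointSched n (startBefore k t) t := by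
  intro i j hij
  rw [Set.disjoint_left]
  intro x hi hj
  rw [Set.mem_Ico] at hi hj
  rcases (hk.ne hij).lt_or_gt with h | h
  · have := startBefore_add_le hk t h
    omega
  · have := startBefore_add_le hk t h
    omega

theorem backToBack_startBefore {n : ℕ} {α : Type*} [LinearOrder α] {k : Fin n → α}
    (hk : Function.Injective k) (t : Fin n → ℕ) : BackToBack n (startBefore k t) t := by
  have h : (Finset.univ.biUnion fun i =>
      Finset.Ico (startBefore k t i) (startBefore k t i + t i)) = Finset.Ico 0 (∑ i, t i) := by
    refine Finset.eq_of_subset_of_card_le ?_ ?_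
    · refine Finset.biUnion_subset.2 fun i _ => Finset.Ico_subset_Ico (Nat.zero_le _) ?_
      rw [startBefore_add hk]
      exact Finset.sum_le_sum_of_subset (Finset.filter_subset _ _)
    · rw [(disjointSched_startBefore hk t).card_biUnion]
      simp
  rw [BackToBack, ← Finset.coe_Ico, ← h]
  simp

/-- Pairwise disjoint non-tardy blocks with deadlines at most `D` have total duration at
most `D`. -/
theorem DisjointSched.sum_le_of_nonTardy {n : ℕ} {d b t : Fin n → ℕ} (h : DisjointSched n b t)
    (hnt : NonTardy n d b t) {s : Finset (Fin n)} {D : ℕ} (hs : ∀ i ∈ s, d i ≤ D) :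
    ∑ i ∈ s, t i ≤ D := by
  rw [← h.card_biUnion]
  calc _ ≤ (Finset.range D).card := by
        refine Finset.card_le_card (Finset.biUnion_subset.2 fun i hi x hx => ?_)
        rw [Finset.mem_Ico] at hx
        have h1 := hnt i (by omega)
        have h2 := hs i hi
        rw [Finset.mem_range]
        omega
    _ = D := Finset.card_range D

/-- Theorem 1, restricted to linear contiguous schedules: every linear contiguous
schedule is dominated by one that is back-to-back, non-tardy, and processes its
positive-duration blocks in nondecreasing order of deadlines. -/
theorem stmt5 (n : ℕ) (d : Fin n → ℕ) (M : Fin n → ℕ → ℝ)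
    (hMmono : ∀ i, Monotone (M i)) (hM0 : ∀ i, M i 0 = 0)
    (hM01 : ∀ i t, 0 ≤ M i t ∧ M i t ≤ 1)
    (b t : Fin n → ℕ) (hdisj : DisjointSched n b t) :
    ∃ b' t' : Fin n → ℕ, DisjointSched n b' t' ∧ BackToBack n b' t' ∧
      NonTardy n d b' t' ∧
      (∀ i j, 0 < t' i → 0 < t' j → b' i < b' j → d i ≤ d j) ∧
      overallSuccess n d M b t ≤ overallSuccess n d M b' t' := by
  set u : Fin n → ℕ := fun i => min (t i) (d i - b i) with hu
  set k : Fin n → ℕ ×ₗ Fin n := fun i => toLex (d i, i)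
  have hk : Function.Injective k := fun i j h => (Prod.ext_iff.1 (toLex.injective h)).2
  have hkd : ∀ {i j}, k i ≤ k j → d i ≤ d j := by
    intro i j h
    rcases Prod.Lex.toLex_le_toLex.1 h with h | h
    · exact h.le
    · exact h.1.le
  have hudisj : DisjointSched n b u := fun i j hij =>
    (hdisj i j hij).mono
      (Set.Ico_subset_Ico_right (Nat.add_le_add_left (min_le_left _ _) _))
      (Set.Ico_subset_Ico_right (Nat.add_le_add_left (min_le_left _ _) _))
  have hunt : NonTardy n d b u := fun i hi => by
    simp only [hu] at hi ⊢
    omega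
  have hle : ∀ i, startBefore k u i + u i ≤ d i := fun i => by
    rw [startBefore_add hk]
    refine hudisj.sum_le_of_nonTardy hunt fun j hj => hkd ?_
    simpa using hj
  refine ⟨startBefore k u, u, disjointSched_startBefore hk u, backToBack_startBefore hk u,
    fun i _ => hle i, fun i j _ _ hij => ?_, ?_⟩
  · rcases le_or_gt (k i) (k j) with h | h
    · exact hkd h
    · have := startBefore_add_le hk u h
      omega
  · refine sub_le_sub_left (Finset.prod_le_prod (fun i _ => ?_) fun i _ => ?_) 1
    · unfold procSuccess
      split_ifs
      · exact sub_nonneg.2 (hM01 _ _).2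
      · norm_num
    · refine sub_le_sub_left ?_ 1
      have h := hle i
      unfold procSuccess
      rw [if_pos (by omega : startBefore k u i ≤ d i),
        min_eq_left (by omega : u i ≤ d i - startBefore k u i)]
      split_ifs
      · exact le_rfl
      · exact (hM01 _ _).1
end

section
/- (Theorem 2, value correctness of the dynamic program.) Consider a known-deadline instance with deadlines sorted so that d_1 ≤ d_2 ≤ … ≤ d_n, and assume M_l(t) < 1 for all l and t. Define LPF_l(j) = log(1 − M_l(j)), and define OPT(t, l) for t ∈ ℕ and 1 ≤ l ≤ n+1 by the backward recursion OPT(t, n+1) = 0 and OPT(t, l) = max_{0 ≤ j ≤ d_l ∸ t} ( OPT(t + j, l + 1) − LPF_l(j) ), where ∸ denotes truncated (natural-number) subtraction. Then OPT(0, 1) = max { ∑_{l=1}^{n} −log(1 − M_l(t_l)) : (t_1, …, t_n) ∈ ℕ^n such that for every l with t_l > 0, ∑_{l'=1}^{l} t_{l'} ≤ d_l }, i.e., the recursion computes the maximum total negated log-failure-probability over all non-tardy back-to-back schedules that allocate computation to the processes in nondecreasing order of deadlines. -/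
/-- The dynamic program of Theorem 2, computed over the list of remaining
(deadline, performance-profile) pairs: `OPTrec [] t = 0` (i.e. `OPT (t, n+1) = 0`) and
`OPTrec ((d_l, M_l) :: rest) t = max_{0 ≤ j ≤ d_l ∸ t} (OPTrec rest (t + j) - log (1 - M_l j))`. -/
noncomputable def OPTrec : List (ℕ × (ℕ → ℝ)) → ℕ → ℝ
  | [], _ => 0
  | (dl, Ml) :: rest, t =>
      (Finset.range (dl - t + 1)).sup'
        (Finset.nonempty_range_iff.mpr (Nat.succ_ne_zero _))
        (fun j => OPTrec rest (t + j) - Real.log (1 - Ml j))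

theorem Fin.sum_Iic_succ_eq_add {n : ℕ} (f : Fin (n + 1) → ℕ) (l : Fin n) :
    ∑ i ∈ Finset.Iic l.succ, f i = f 0 + ∑ i ∈ Finset.Iic l, f i.succ := by
  have key : ∀ {m : ℕ} (g : Fin m → ℕ) (k : Fin m),
      ∑ i ∈ Finset.Iic k, g i = ∑ i, if i ≤ k then g i else 0 := by
    intro m g k
    rw [← Finset.sum_filter]
    congr 1
    ext i
    simp
  rw [key, key, Fin.sum_univ_succ]
  simp

/-- Starting the schedule at time `s`, the dynamic program computes the optimal value
(for any processing order, not only for sorted deadlines). -/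
theorem isGreatest_OPTrec_ofFn (n : ℕ) (d : Fin n → ℕ) (M : Fin n → ℕ → ℝ) (s : ℕ) :
    IsGreatest
      { x : ℝ | ∃ t : Fin n → ℕ,
          (∀ l, 0 < t l → s + ∑ l' ∈ Finset.Iic l, t l' ≤ d l) ∧
          x = ∑ l, -Real.log (1 - M l (t l)) }
      (OPTrec (List.ofFn fun l => (d l, M l)) s) := by
  induction n generalizing s with
  | zero =>
    refine ⟨⟨fun _ => 0, by simp, by simp [OPTrec]⟩, ?_⟩
    rintro x ⟨t, -, rfl⟩
    simp [OPTrec]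
  | succ n ih =>
    have ih' := fun s => ih (fun l => d l.succ) (fun l => M l.succ) s
    rw [List.ofFn_succ, OPTrec]
    constructor
    · obtain ⟨j, hj, hmax⟩ := Finset.exists_mem_eq_sup' (Finset.nonempty_range_iff.mpr
        (Nat.succ_ne_zero (d 0 - s))) (fun j => OPTrec (List.ofFn fun l : Fin n =>
          (d l.succ, M l.succ)) (s + j) - Real.log (1 - M 0 j))
      rw [Finset.mem_range] at hj
      obtain ⟨t, ht, hval⟩ := (ih' (s + j)).1
      refine ⟨Fin.cons j t, fun l => ?_, ?_⟩
      · refine Fin.cases ?_ (fun l => ?_) l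
        · intro hpos
          have h0 : Finset.Iic (0 : Fin (n + 1)) = {0} := by ext i; simp
          simp only [h0, Finset.sum_singleton, Fin.cons_zero] at hpos ⊢
          omega
        · intro hpos
          rw [Fin.sum_Iic_succ_eq_add]
          simp only [Fin.cons_zero, Fin.cons_succ] at hpos ⊢
          have := ht l hpos
          omega
      · rw [Fin.sum_univ_succ]
        simp only [Fin.cons_zero, Fin.cons_succ]
        rw [← hval]
        exact hmax.trans (by ring)
    · rintro x ⟨t, ht, rfl⟩
      have hj : t 0 ∈ Finset.range (d 0 - s + 1) := by
        have h0 : Finset.Iic (0 : Fin (n + 1)) = {0} := by ext i; simp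
        have := ht 0
        simp only [h0, Finset.sum_singleton] at this
        rw [Finset.mem_range]
        omega
      have htail := (ih' (s + t 0)).2 ⟨fun l => t l.succ, fun l hl => by
        have := ht l.succ hl
        rw [Fin.sum_Iic_succ_eq_add] at this
        simpa only [add_assoc] using this, rfl⟩
      refine le_trans ?_ (Finset.le_sup' _ hj)
      rw [Fin.sum_univ_succ]
      linarith

/-- Theorem 2 (value correctness of the dynamic program): for deadlines sorted in
nondecreasing order, `OPT (0, 1)` is the maximum total negated log-failure-probability
over all non-tardy back-to-back schedules processing the processes in deadline order. -/
theorem stmt6 (n : ℕ) (d : Fin n → ℕ) (M : Fin n → ℕ → ℝ)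
    (hd : Monotone d)
    (hMmono : ∀ l, Monotone (M l)) (hM0 : ∀ l, M l 0 = 0)
    (hMnonneg : ∀ l t, 0 ≤ M l t) (hMlt : ∀ l t, M l t < 1) :
    IsGreatest
      { x : ℝ | ∃ t : Fin n → ℕ,
          (∀ l, 0 < t l → ∑ l' ∈ Finset.Iic l, t l' ≤ d l) ∧
          x = ∑ l, -Real.log (1 - M l (t l)) }
      (OPTrec (List.ofFn fun l => (d l, M l)) 0) := by
  simpa only [zero_add] using isGreatest_OPTrec_ofFn n d M 0
end

section
/- (Earliest-deadline-first feasibility, unit-level.) Let n ∈ ℕ, let l be a finite list over Fin n, and let d : Fin n → ℕ. Suppose every position k < |l| satisfies k < d(l[k]) (each unit of computation of a process occurs strictly before that process's deadline). If l' is any permutation of l such that the sequence k ↦ d(l'[k]) is nondecreasing, then every position k < |l'| also satisfies k < d(l'[k]). -/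
/-- If `p` fails at every position from `k` on, at most `k` entries satisfy `p`. -/
theorem List.countP_le_of_forall_ge_not {α : Type*} (p : α → Bool) (l : List α) (k : ℕ)
    (hp : ∀ j (h : j < l.length), k ≤ j → ¬p l[j]) : l.countP p ≤ k := by
  have hdrop : (l.drop k).countP p = 0 := by
    rw [List.countP_eq_zero]
    intro a ha
    obtain ⟨i, hi, rfl⟩ := List.mem_iff_getElem.mp ha
    rw [List.getElem_drop]
    exact hp _ _ (Nat.le_add_right k i)
  rw [← List.take_append_drop k l, List.countP_append, hdrop, Nat.add_zero]
  exact List.countP_le_length.trans (List.length_take_le k l)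

/-- If `p` holds at the first `k` positions, at least `k` entries satisfy `p`. -/
theorem List.le_countP_of_forall_lt {α : Type*} (p : α → Bool) (l : List α) (k : ℕ)
    (hk : k ≤ l.length) (hp : ∀ j (h : j < l.length), j < k → p l[j]) : k ≤ l.countP p := by
  have htake : (l.take k).countP p = (l.take k).length := by
    rw [List.countP_eq_length]
    intro a ha
    obtain ⟨i, hi, rfl⟩ := List.mem_iff_getElem.mp ha
    rw [List.getElem_take]
    rw [List.length_take] at hi
    exact hp _ _ (lt_of_lt_of_le hi (min_le_left _ _))
  calc k = (l.take k).countP p := by rw [htake, List.length_take_of_le hk]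
    _ ≤ l.countP p := (List.take_sublist k l).countP_le

/-- Earliest-deadline-first feasibility, unit-level: if a unit-level computation
schedule `l` is feasible (every time unit is allocated strictly before the deadline of
its process), then any rearrangement `l'` of `l` in nondecreasing order of deadlines is
also feasible. -/
theorem stmt7 (n : ℕ) (l : List (Fin n)) (d : Fin n → ℕ)
    (hfeas : ∀ k (h : k < l.length), k < d (l.get ⟨k, h⟩))
    (l' : List (Fin n)) (hperm : l.Perm l')
    (hsorted : ∀ k₁ k₂ (h₁ : k₁ < l'.length) (h₂ : k₂ < l'.length),
      k₁ ≤ k₂ → d (l'.get ⟨k₁, h₁⟩) ≤ d (l'.get ⟨k₂, h₂⟩)) :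
    ∀ k (h : k < l'.length), k < d (l'.get ⟨k, h⟩) := by
  intro k hk
  by_contra! hle
  have hupper : l.countP (fun x => decide (d x ≤ k)) ≤ k := by
    refine List.countP_le_of_forall_ge_not _ l k fun j hj hkj => ?_
    simpa using lt_of_le_of_lt hkj (hfeas j hj)
  have hlower : k + 1 ≤ l'.countP (fun x => decide (d x ≤ k)) := by
    refine List.le_countP_of_forall_lt _ l' (k + 1) hk fun j hj hjk => ?_
    simpa using (hsorted j k hj hk (Nat.le_of_lt_succ hjk)).trans hle
  rw [← hperm.countP_eq] at hlower
  omega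
end

section
/- (Contiguity rearrangement, unit-level; core of Theorem 4.) Let n ∈ ℕ, let l be a finite list over Fin n, and let d : Fin n → ℕ. Suppose every position k < |l| satisfies k < d(l[k]). Then there exists a permutation l' of l such that every position k < |l'| satisfies k < d(l'[k]), and in l' the occurrences of each value are contiguous: for all positions p < q < r, if l'[p] = l'[r] then l'[q] = l'[p]. -/
/-- In a feasible schedule, at most `D` units belong to processes with deadline at most `D`. -/
theorem countP_le_of_feasible {α : Type*} (d : α → ℕ) (l : List α)
    (hfeas : ∀ k (h : k < l.length), k < d l[k]) (D : ℕ) :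
    l.countP (fun a => d a ≤ D) ≤ D := by
  have htake : (l.take D).countP (fun a => d a ≤ D) ≤ D :=
    List.countP_le_length.trans (by simp)
  have hdrop : (l.drop D).countP (fun a => d a ≤ D) = 0 := by
    rw [List.countP_eq_zero]
    intro a ha
    obtain ⟨i, hi, rfl⟩ := List.mem_iff_getElem.mp ha
    rw [List.length_drop] at hi
    have := hfeas (D + i) (by omega)
    simp only [List.getElem_drop, decide_eq_true_eq]
    omega
  rw [← List.take_append_drop D l, List.countP_append, hdrop]
  exact htake

/-- Rearranging a feasible schedule by nondecreasing deadline keeps it feasible. -/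
theorem feasible_of_perm_of_monotone {α : Type*} (d : α → ℕ) {l l' : List α}
    (hperm : l.Perm l') (hfeas : ∀ k (h : k < l.length), k < d l[k])
    (hmono : ∀ i j (hj : j < l'.length) (hij : i ≤ j), d l'[i] ≤ d l'[j])
    (k : ℕ) (hk : k < l'.length) : k < d l'[k] := by
  have hle := countP_le_of_feasible d l hfeas (d l'[k])
  have hall : (l'.take (k + 1)).countP (fun a => d a ≤ d l'[k]) = (l'.take (k + 1)).length := by
    rw [List.countP_eq_length]
    intro a ha
    obtain ⟨i, hi, rfl⟩ := List.mem_iff_getElem.mp ha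
    rw [List.length_take] at hi
    simpa using hmono i k hk (by omega)
  have hsub := (List.take_sublist (k + 1) l').countP_le (p := fun a => d a ≤ d l'[k])
  rw [hall, List.length_take, ← hperm.countP_eq] at hsub
  omega

/-- Contiguity rearrangement, unit-level (core of Theorem 4): every feasible
unit-level schedule can be rearranged into a feasible one in which the occurrences
of each process are contiguous. -/
theorem stmt8 (n : ℕ) (l : List (Fin n)) (d : Fin n → ℕ)
    (hfeas : ∀ k (h : k < l.length), k < d (l.get ⟨k, h⟩)) :
    ∃ l' : List (Fin n), l.Perm l' ∧
      (∀ k (h : k < l'.length), k < d (l'.get ⟨k, h⟩)) ∧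
      (∀ p q r (hr : r < l'.length) (hpq : p < q) (hqr : q < r),
        l'.get ⟨p, by omega⟩ = l'.get ⟨r, hr⟩ →
        l'.get ⟨q, by omega⟩ = l'.get ⟨p, by omega⟩) := by
  let key : Fin n → ℕ ×ₗ Fin n := fun a => toLex (d a, a)
  have hinj : Function.Injective key := fun a b hab => by
    simpa [key] using congrArg (fun x => (ofLex x).2) hab
  let l' := l.mergeSort (fun a b => key a ≤ key b)
  have hperm : l.Perm l' := (List.mergeSort_perm l _).symm
  have hpair : l'.Pairwise (fun a b => key a ≤ key b) := by
    have := List.pairwise_mergeSort (le := fun a b => decide (key a ≤ key b))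
      (fun a b c hab hbc => by
        simp only [decide_eq_true_eq] at *
        exact hab.trans hbc)
      (fun a b => by simpa using le_total (key a) (key b)) l
    simpa using this
  have hmono : ∀ i j (hj : j < l'.length) (hij : i ≤ j), key l'[i] ≤ key l'[j] := by
    intro i j hj hij
    rcases hij.eq_or_lt with rfl | hij
    · exact le_rfl
    · exact List.pairwise_iff_getElem.mp hpair i j (by omega) hj hij
  refine ⟨l', hperm, feasible_of_perm_of_monotone d hperm hfeas ?_, ?_⟩
  · intro i j hj hij
    exact Prod.Lex.monotone_fst _ _ (hmono i j hj hij)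
  · intro p q r hr hpq hqr hpr
    simp only [List.get_eq_getElem] at hpr ⊢
    refine hinj (le_antisymm ?_ (hmono p q (by omega) hpq.le))
    rw [hpr]
    exact hmono q r hr hqr.le
end

section
/- (Theorem 4, concretized.) In every KID-CoPE instance, for every legal linear policy σ there exists a legal linear contiguous policy σ' obtained from σ by permuting the computation entries among the positions occupied by computation entries in σ (so that σ' has the same base-level entries at the same positions as σ, and n_i(σ') = n_i(σ) for every process i). Consequently p(σ') = p(σ), and hence among legal linear policies, contiguous policies achieve the optimal success probability. -/
/-- `T(k)`: the number of computation entries among the first `k` entries of `σ`. -/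
def compCount {n : ℕ} {B : Type*} (σ : List (Fin n ⊕ B)) (k : ℕ) : ℕ :=
  (σ.take k).countP Sum.isLeft

/-- `L(k)`: the number of base-level entries among the first `k` entries of `σ`. -/
def baseCount {n : ℕ} {B : Type*} (σ : List (Fin n ⊕ B)) (k : ℕ) : ℕ :=
  (σ.take k).countP Sum.isRight

/-- The list of base-level entries of `σ`, in order. -/
def baseSeq {n : ℕ} {B : Type*} (σ : List (Fin n ⊕ B)) : List B :=
  σ.filterMap Sum.getRight?

/-- `F(k)`: the maximum of `0` and of `T(p) + dur(σ[p])` over all base-level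
positions `p < k` (the time by which all base-level actions started before
position `k` have finished executing). -/
def finishBound {n : ℕ} {B : Type*} (dur : B → ℕ) (σ : List (Fin n ⊕ B)) (k : ℕ) : ℕ :=
  (Finset.range k).sup fun p =>
    match σ[p]? with
    | some (Sum.inr b) => compCount σ p + dur b
    | _ => 0

/-- `R_i(k)`: the total duration of the actions of `Hi` not started before
position `k`, given that `c` base-level actions were started before position `k`. -/
def remDur {B : Type*} (dur : B → ℕ) (Hi : List B) (c : ℕ) : ℕ :=
  ((Hi.drop c).map dur).sum

/-- A linear policy `σ` is legal if (i) its base-level entries form a prefix of some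
`H i`; (ii) base-level executions do not overlap; and (iii) every computation entry
`c i` is valid and non-tardy. -/
def Legal {n : ℕ} {B : Type*} (dur : B → ℕ) (H : Fin n → List B) (d : Fin n → ℕ)
    (σ : List (Fin n ⊕ B)) : Prop :=
  (∃ i, baseSeq σ <+: H i) ∧
  (∀ q (b : B), σ[q]? = some (Sum.inr b) → finishBound dur σ q ≤ compCount σ q) ∧
  (∀ k (i : Fin n), σ[k]? = some (Sum.inl i) →
    baseSeq (σ.take k) <+: H i ∧
    max (compCount σ k + 1) (finishBound dur σ k) +
        remDur dur (H i) (baseCount σ k) ≤ d i)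

/-- The success probability `p(σ) = 1 - ∏ᵢ (1 - Mᵢ(nᵢ(σ)))` of a legal linear policy,
where `nᵢ(σ)` is the number of computation entries `c i` in `σ`. -/
noncomputable def policyP {n : ℕ} {B : Type*} [DecidableEq B] (M : Fin n → ℕ → ℝ)
    (σ : List (Fin n ⊕ B)) : ℝ :=
  1 - ∏ i, (1 - M i (σ.count (Sum.inl i)))

/-- `σ` is contiguous: no computation entry of another process occurs between two
computation entries of the same process. -/
def Contiguous {n : ℕ} {B : Type*} (σ : List (Fin n ⊕ B)) : Prop :=
  ∀ (p q r : ℕ) (i j : Fin n), p < q → q < r →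
    σ[p]? = some (Sum.inl i) → σ[r]? = some (Sum.inl i) →
    σ[q]? = some (Sum.inl j) → j = i

/-- The list of processes of the computation entries of `σ`, in order. -/
def compSeq {n : ℕ} {B : Type*} (σ : List (Fin n ⊕ B)) : List (Fin n) :=
  σ.filterMap Sum.getLeft?

@[simp]
theorem compSeq_nil {n : ℕ} {B : Type*} : compSeq ([] : List (Fin n ⊕ B)) = [] := rfl

@[simp]
theorem compSeq_cons_inl {n : ℕ} {B : Type*} (i : Fin n) (σ : List (Fin n ⊕ B)) :
    compSeq (Sum.inl i :: σ) = i :: compSeq σ := rfl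

@[simp]
theorem compSeq_cons_inr {n : ℕ} {B : Type*} (b : B) (σ : List (Fin n ⊕ B)) :
    compSeq (Sum.inr b :: σ) = compSeq σ := rfl

/-- A list can be permuted so that equal elements become adjacent and no element moves
beyond the last occurrence of its value in the original list. -/
theorem exists_perm_grouped {α : Type*} (l : List α) :
    ∃ l' : List α, l'.Perm l ∧
      (∀ (p q r : ℕ) (a b : α), p < q → q < r → l'[p]? = some a → l'[r]? = some a →
        l'[q]? = some b → b = a) ∧
      (∀ (t : ℕ) (a : α), l'[t]? = some a → ∃ s, t ≤ s ∧ l[s]? = some a) := by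
  classical
  induction hN : l.length using Nat.strong_induction_on generalizing l with
  | _ N ih =>
  rcases List.eq_nil_or_concat l with rfl | ⟨l₀, a, rfl⟩
  · exact ⟨[], List.Perm.refl _, by simp, by simp⟩
  have hle : (l₀.filter (· ≠ a)).length ≤ l₀.length := List.length_filter_le _ _
  obtain ⟨g, hperm, hcont, hlast⟩ := ih (l₀.filter (· ≠ a)).length
    (by simp at hN; omega) _ rfl
  have hga : ∀ t : ℕ, g[t]? ≠ some a := fun t ht => by
    have := hperm.mem_iff.1 (List.mem_of_getElem? ht)
    simp at this
  have hP : (g ++ (l₀.filter (· = a) ++ [a])).Perm (l₀ ++ [a]) := by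
    rw [← List.append_assoc]
    refine List.Perm.append_right _ ((hperm.append_right _).trans ?_)
    refine List.perm_append_comm.trans ?_
    simpa using List.filter_append_perm (· = a) l₀
  have hright : ∀ (t : ℕ) (b : α), g.length ≤ t →
      (g ++ (l₀.filter (· = a) ++ [a]))[t]? = some b → b = a := by
    intro t b ht h
    rw [List.getElem?_append_right ht] at h
    have := List.mem_of_getElem? h
    simp at this
    tauto
  have hleft : ∀ t : ℕ, (g ++ (l₀.filter (· = a) ++ [a]))[t]? = some a → g.length ≤ t := by
    intro t h
    by_contra! ht
    rw [List.getElem?_append_left ht] at h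
    exact hga t h
  refine ⟨g ++ (l₀.filter (· = a) ++ [a]), hP.trans (by simp), ?_, ?_⟩
  · intro p q r c b hpq hqr hp hr hq
    by_cases hrg : g.length ≤ r
    · obtain rfl := hright r c hrg hr
      exact hright q b ((hleft p hp).trans hpq.le) hq
    · rw [List.getElem?_append_left (by omega)] at hp hq hr
      exact hcont p q r c b hpq hqr hp hr hq
  · intro t b ht
    have hlen : t < (l₀ ++ [a]).length := by
      rw [← hP.length_eq]
      exact (List.getElem?_eq_some_iff.1 ht).1
    by_cases htg : g.length ≤ t
    · obtain rfl := hright t b htg ht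
      exact ⟨l₀.length, by simp at hlen; omega, by simp⟩
    · rw [List.getElem?_append_left (by omega)] at ht
      obtain ⟨s, hts, hs⟩ := hlast t b ht
      obtain ⟨f, hf⟩ := List.sublist_iff_exists_orderEmbedding_getElem?_eq.1
        (List.filter_sublist (l := l₀) (p := fun x => decide (x ≠ a)))
      rw [hf] at hs
      refine ⟨f s, hts.trans f.strictMono.le_apply, ?_⟩
      simp [List.getElem?_append_left (List.getElem?_eq_some_iff.1 hs).1, hs]

/-- The computation entries of a policy can be replaced by any list of the right length,
keeping the base-level entries in place. -/
theorem exists_compSeq_eq {n : ℕ} {B : Type*} (σ : List (Fin n ⊕ B)) (l : List (Fin n))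
    (hl : l.length = (compSeq σ).length) :
    ∃ σ' : List (Fin n ⊕ B), compSeq σ' = l ∧
      σ'.map Sum.getRight? = σ.map Sum.getRight? := by
  induction σ generalizing l with
  | nil => exact ⟨[], by simpa [eq_comm] using hl, rfl⟩
  | cons x σ ih =>
    rcases x with i | b
    · rcases l with _ | ⟨j, l⟩
      · simp at hl
      · obtain ⟨σ', h1, h2⟩ := ih l (by simpa using hl)
        exact ⟨Sum.inl j :: σ', by simpa using h1, by simpa using h2⟩
    · obtain ⟨σ', h1, h2⟩ := ih l (by simpa using hl)
      exact ⟨Sum.inr b :: σ', by simpa using h1, by simpa using h2⟩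

section Shape

variable {n : ℕ} {B : Type*} {σ σ' : List (Fin n ⊕ B)}

theorem baseSeq_congr (h : σ'.map Sum.getRight? = σ.map Sum.getRight?) :
    baseSeq σ' = baseSeq σ := by
  have key : ∀ τ : List (Fin n ⊕ B), baseSeq τ = (τ.map Sum.getRight?).filterMap id := by
    intro τ
    simp [baseSeq, List.filterMap_map]
  rw [key, key, h]

theorem map_take_congr (h : σ'.map Sum.getRight? = σ.map Sum.getRight?) (k : ℕ) :
    (σ'.take k).map Sum.getRight? = (σ.take k).map Sum.getRight? := by
  rw [List.map_take, List.map_take, h]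

theorem compCount_congr (h : σ'.map Sum.getRight? = σ.map Sum.getRight?) (k : ℕ) :
    compCount σ' k = compCount σ k := by
  have key : ∀ τ : List (Fin n ⊕ B),
      τ.countP Sum.isLeft = (τ.map Sum.getRight?).countP Option.isNone := by
    intro τ
    rw [List.countP_map]
    congr 1
    funext x
    cases x <;> rfl
  rw [compCount, compCount, key, key, map_take_congr h]

theorem baseCount_eq_length (σ : List (Fin n ⊕ B)) (k : ℕ) :
    baseCount σ k = (baseSeq (σ.take k)).length := by
  rw [baseCount, baseSeq, List.length_filterMap_eq_countP]
  congr 1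
  funext x
  cases x <;> rfl

theorem baseCount_congr (h : σ'.map Sum.getRight? = σ.map Sum.getRight?) (k : ℕ) :
    baseCount σ' k = baseCount σ k := by
  rw [baseCount_eq_length, baseCount_eq_length, baseSeq_congr (map_take_congr h k)]

theorem getElem?_inr_congr (h : σ'.map Sum.getRight? = σ.map Sum.getRight?) (k : ℕ) (b : B) :
    σ'[k]? = some (Sum.inr b) ↔ σ[k]? = some (Sum.inr b) := by
  have key : ∀ τ : List (Fin n ⊕ B),
      τ[k]? = some (Sum.inr b) ↔ (τ.map Sum.getRight?)[k]? = some (some b) := by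
    intro τ
    rw [List.getElem?_map]
    rcases τ[k]? with _ | _ | _ <;> simp
  rw [key, key, h]

theorem exists_getElem?_inl_of_congr (h : σ'.map Sum.getRight? = σ.map Sum.getRight?) {k : ℕ}
    {i : Fin n} (hk : σ'[k]? = some (Sum.inl i)) : ∃ j, σ[k]? = some (Sum.inl j) := by
  have hk' : (σ.map Sum.getRight?)[k]? = some none := by
    rw [← h, List.getElem?_map, hk]
    rfl
  rw [List.getElem?_map] at hk'
  rcases hx : σ[k]? with _ | j | b
  · simp [hx] at hk'
  · exact ⟨j, rfl⟩
  · simp [hx] at hk'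

theorem finishBound_congr (dur : B → ℕ) (h : σ'.map Sum.getRight? = σ.map Sum.getRight?)
    (k : ℕ) : finishBound dur σ' k = finishBound dur σ k := by
  refine Finset.sup_congr rfl fun p _ => ?_
  rcases hx : σ[p]? with _ | j | b <;> rcases hy : σ'[p]? with _ | j' | b'
  all_goals try rfl
  · have := (getElem?_inr_congr h p b').1 hy
    simp [hx] at this
  · have := (getElem?_inr_congr h p b').1 hy
    simp [hx] at this
  · have := (getElem?_inr_congr h p b).2 hx
    simp [hy] at this
  · have := (getElem?_inr_congr h p b).2 hx
    simp [hy] at this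
  · have := (getElem?_inr_congr h p b).2 hx
    rw [hy] at this
    cases this
    simp only [compCount_congr h]

end Shape

section Positions

variable {n : ℕ} {B : Type*} {σ : List (Fin n ⊕ B)}

theorem compCount_mono (σ : List (Fin n ⊕ B)) : Monotone (compCount σ) := fun _ _ h =>
  (List.take_sublist_take_left h).countP_le

theorem compCount_succ_of_inl {k : ℕ} {i : Fin n} (hk : σ[k]? = some (Sum.inl i)) :
    compCount σ (k + 1) = compCount σ k + 1 := by
  simp [compCount, List.take_add_one, hk]

theorem compCount_lt_of_inl {k m : ℕ} {i : Fin n} (hk : σ[k]? = some (Sum.inl i))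
    (hkm : k < m) : compCount σ k < compCount σ m := by
  have := compCount_mono σ (Nat.succ_le_of_lt hkm)
  rw [Nat.succ_eq_add_one, compCount_succ_of_inl hk] at this
  omega

theorem compSeq_getElem?_compCount {k : ℕ} {i : Fin n} (hk : σ[k]? = some (Sum.inl i)) :
    (compSeq σ)[compCount σ k]? = some i := by
  induction σ generalizing k with
  | nil => simp at hk
  | cons x σ ih =>
    rcases k with _ | k
    · simp at hk
      simp [hk, compCount]
    · have := ih (k := k) (by simpa using hk)
      rcases x with j | b <;> simpa [compCount, List.countP_cons] using this

theorem exists_of_compSeq_getElem? {s : ℕ} {i : Fin n} (hs : (compSeq σ)[s]? = some i) :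
    ∃ k, σ[k]? = some (Sum.inl i) ∧ compCount σ k = s := by
  induction σ generalizing s with
  | nil => simp at hs
  | cons x σ ih =>
    rcases x with j | b
    · rcases s with _ | s
      · exact ⟨0, by simpa using hs, by simp [compCount]⟩
      · obtain ⟨k, h1, h2⟩ := ih (s := s) (by simpa using hs)
        exact ⟨k + 1, by simpa using h1, by simpa [compCount, List.countP_cons] using h2⟩
    · obtain ⟨k, h1, h2⟩ := ih (s := s) (by simpa using hs)
      exact ⟨k + 1, by simpa using h1, by simpa [compCount, List.countP_cons] using h2⟩

theorem count_inl_eq_count_compSeq [DecidableEq B] (σ : List (Fin n ⊕ B)) (i : Fin n) :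
    σ.count (Sum.inl i) = (compSeq σ).count i := by
  induction σ with
  | nil => rfl
  | cons x σ ih =>
    rcases x with j | b
    · have hb : ((Sum.inl j : Fin n ⊕ B) == Sum.inl i) = (j == i) := rfl
      rw [List.count_cons, hb, ih, compSeq_cons_inl, List.count_cons]
    · have hb : ((Sum.inr b : Fin n ⊕ B) == Sum.inl i) = false := rfl
      simp [List.count_cons, hb, ih]

theorem baseSeq_take_prefix (σ : List (Fin n ⊕ B)) {k m : ℕ} (h : k ≤ m) :
    baseSeq (σ.take k) <+: baseSeq (σ.take m) :=
  (List.take_prefix_take_left h).filterMap _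

theorem finishBound_mono (dur : B → ℕ) (σ : List (Fin n ⊕ B)) :
    Monotone (finishBound dur σ) := fun _ _ h =>
  Finset.sup_mono (Finset.range_mono h)

theorem le_finishBound_succ {dur : B → ℕ} {m : ℕ} {b : B} (hm : σ[m]? = some (Sum.inr b)) :
    compCount σ m + dur b ≤ finishBound dur σ (m + 1) := by
  have := Finset.le_sup (f := fun p => match σ[p]? with
    | some (Sum.inr b) => compCount σ p + dur b
    | _ => 0) (Finset.self_mem_range_succ m)
  simp only [hm] at this
  exact this

theorem remDur_baseCount_of_inr {dur : B → ℕ} {Hi : List B} {m : ℕ} {b : B}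
    (hm : σ[m]? = some (Sum.inr b)) (hpre : baseSeq (σ.take (m + 1)) <+: Hi) :
    remDur dur Hi (baseCount σ m) = dur b + remDur dur Hi (baseCount σ (m + 1)) := by
  obtain ⟨t, rfl⟩ := hpre
  have hs : baseSeq (σ.take (m + 1)) = baseSeq (σ.take m) ++ [b] := by
    simp [baseSeq, List.take_add_one, hm]
  have h2 : (baseSeq (σ.take m) ++ [b] ++ t).drop ((baseSeq (σ.take m)).length + 1) = t :=
    List.drop_left' (by simp)
  rw [baseCount_eq_length, baseCount_eq_length, hs, List.length_append, List.length_singleton,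
    remDur, remDur, h2]
  simp

theorem remDur_baseCount_of_not_inr {dur : B → ℕ} {Hi : List B} {m : ℕ}
    (hm : ∀ b, σ[m]? ≠ some (Sum.inr b)) :
    remDur dur Hi (baseCount σ (m + 1)) = remDur dur Hi (baseCount σ m) := by
  congr 1
  rcases hx : σ[m]? with _ | j | b
  · simp [baseCount, List.take_add_one, hx]
  · simp [baseCount, List.take_add_one, hx]
  · exact absurd hx (hm b)

/-- The earliest completion time of process `i` after a computation entry at position `k` does
not decrease at later positions, as long as the base-level entries follow its prefix. -/
theorem completion_le_of_lt {dur : B → ℕ} {Hi : List B}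
    (hov : ∀ q (b : B), σ[q]? = some (Sum.inr b) → finishBound dur σ q ≤ compCount σ q)
    {k m : ℕ} {j : Fin n} (hk : σ[k]? = some (Sum.inl j)) (hkm : k < m)
    (hpre : baseSeq (σ.take m) <+: Hi) :
    max (compCount σ k + 1) (finishBound dur σ k) + remDur dur Hi (baseCount σ k) ≤
      max (compCount σ m) (finishBound dur σ m) + remDur dur Hi (baseCount σ m) := by
  induction m, hkm using Nat.le_induction with
  | base =>
    rw [Nat.succ_eq_add_one, compCount_succ_of_inl hk, remDur_baseCount_of_not_inr (by simp [hk])]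
    have := finishBound_mono dur σ (Nat.le_add_right k 1)
    omega
  | succ m hkm ih =>
    refine (ih ((baseSeq_take_prefix σ (Nat.le_succ m)).trans hpre)).trans ?_
    by_cases hx : ∃ b, σ[m]? = some (Sum.inr b)
    · obtain ⟨b, hx⟩ := hx
      rw [remDur_baseCount_of_inr hx hpre]
      have := le_finishBound_succ (dur := dur) hx
      have := hov m b hx
      omega
    · push Not at hx
      rw [remDur_baseCount_of_not_inr hx]
      have := finishBound_mono dur σ (Nat.le_add_right m 1)
      have := compCount_mono σ (Nat.le_add_right m 1)
      omega

theorem completion_le {dur : B → ℕ} {Hi : List B}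
    (hov : ∀ q (b : B), σ[q]? = some (Sum.inr b) → finishBound dur σ q ≤ compCount σ q)
    {k m : ℕ} {j : Fin n} (hk : σ[k]? = some (Sum.inl j)) (hkm : k ≤ m)
    (hpre : baseSeq (σ.take m) <+: Hi) :
    max (compCount σ k + 1) (finishBound dur σ k) + remDur dur Hi (baseCount σ k) ≤
      max (compCount σ m + 1) (finishBound dur σ m) + remDur dur Hi (baseCount σ m) := by
  rcases hkm.eq_or_lt with rfl | hlt
  · exact le_rfl
  · have := completion_le_of_lt hov hk hlt hpre
    omega

end Positions

/-- Theorem 4, concretized: every legal linear policy of a KID-CoPE instance can be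
rearranged, by permuting the computation entries among the computation positions,
into a legal linear contiguous policy with the same success probability. -/
theorem stmt9 {B : Type*} [DecidableEq B] (n : ℕ) (dur : B → ℕ)
    (hdur : ∀ b, 1 ≤ dur b)
    (H : Fin n → List B) (d : Fin n → ℕ) (M : Fin n → ℕ → ℝ)
    (hMmono : ∀ i, Monotone (M i)) (hM0 : ∀ i, M i 0 = 0)
    (hM01 : ∀ i t, 0 ≤ M i t ∧ M i t ≤ 1)
    (σ : List (Fin n ⊕ B)) (hσ : Legal dur H d σ) :
    ∃ σ' : List (Fin n ⊕ B), Legal dur H d σ' ∧ Contiguous σ' ∧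
      σ'.length = σ.length ∧
      (∀ (k : ℕ) (b : B), σ'[k]? = some (Sum.inr b) ↔ σ[k]? = some (Sum.inr b)) ∧
      (∀ i, σ'.count (Sum.inl i) = σ.count (Sum.inl i)) ∧
      policyP M σ' = policyP M σ := by
  obtain ⟨l, hperm, hcont, hlast⟩ := exists_perm_grouped (compSeq σ)
  obtain ⟨σ', rfl, hshape⟩ := exists_compSeq_eq σ l hperm.length_eq
  obtain ⟨hpre, hov, hcomp⟩ := hσ
  have hcount : ∀ i, σ'.count (Sum.inl i) = σ.count (Sum.inl i) := fun i => by
    rw [count_inl_eq_count_compSeq, count_inl_eq_count_compSeq, hperm.count_eq]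
  refine ⟨σ', ⟨?_, ?_, ?_⟩, ?_, by simpa using congrArg List.length hshape,
    getElem?_inr_congr hshape, hcount, by simp only [policyP, hcount]⟩
  · rwa [baseSeq_congr hshape]
  · intro q b hq
    rw [finishBound_congr dur hshape, compCount_congr hshape]
    exact hov q b ((getElem?_inr_congr hshape q b).1 hq)
  · intro k i hk
    obtain ⟨j, hj⟩ := exists_getElem?_inl_of_congr hshape hk
    obtain ⟨s, hs, hsi⟩ := hlast _ i (compSeq_getElem?_compCount hk)
    obtain ⟨m, hm, rfl⟩ := exists_of_compSeq_getElem? hsi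
    rw [compCount_congr hshape] at hs
    have hkm : k ≤ m := by
      by_contra! hlt
      exact absurd (compCount_lt_of_inl hm hlt) (by omega)
    obtain ⟨hprem, hdm⟩ := hcomp m i hm
    rw [baseSeq_congr (map_take_congr hshape k), finishBound_congr dur hshape,
      compCount_congr hshape, baseCount_congr hshape]
    exact ⟨(baseSeq_take_prefix σ hkm).trans hprem, (completion_le hov hj hkm hprem).trans hdm⟩
  · intro p q r i j hpq hqr hp hr hq
    exact hcont _ _ _ i j (compCount_lt_of_inl hp hpq) (compCount_lt_of_inl hq hqr)
      (compSeq_getElem?_compCount hp) (compSeq_getElem?_compCount hr)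
      (compSeq_getElem?_compCount hq)
end
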